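/- Let X be a Hausdorff topological space, Y any topological space, and g : X → Y an open bijection. Suppose there exists a collection 𝓑 of compact subsets of Y with the property that for every x ∈ X there is some B ∈ 𝓑 such that the preimage g⁻¹(B) contains an open neighborhood of x. Then g is a homeomorphism. -/

import Mathlib

/-- Let `X` be a Hausdorff space, `Y` any topological space, and `g : X → Y` an open
bijection.  Suppose there exists a collection `𝓑` of compact subsets of `Y` such that for
every `x ∈ X` there is some `B ∈ 𝓑` whose preimage `g ⁻¹' B` contains an open neighborhood
of `x`.  Then `g` is a homeomorphism. -/
theorem openBijection_isHomeomorph {X Y : Type*} [TopologicalSpace X] [TopologicalSpace Y]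
    [T2Space X] (g : X → Y) (hopen : IsOpenMap g) (hbij : Function.Bijective g)
    (𝓑 : Set (Set Y)) (hcompact : ∀ B ∈ 𝓑, IsCompact B)
    (hnhds : ∀ x : X, ∃ B ∈ 𝓑, g ⁻¹' B ∈ nhds x) :
    IsHomeomorph g := by
  let e := Equiv.ofBijective g hbij
  have hsymm : Continuous e.symm :=
    e.continuous_symm_iff.2 hopen
  refine ⟨continuous_iff_continuousAt.2 fun x => ?_, hopen, hbij⟩
  obtain ⟨B, hB, hx⟩ := hnhds x
  rw [ContinuousAt, (nhds_basis_opens (g x)).tendsto_right_iff]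
  rintro V ⟨hxV, hV⟩
  have hclosed : IsClosed (g ⁻¹' (B \ V)) := by
    have h := (((hcompact B hB).diff hV).image hsymm).isClosed
    rwa [Equiv.image_symm_eq_preimage] at h
  filter_upwards [hx, hclosed.isOpen_compl.mem_nhds fun h => h.2 hxV] with y hyB hy
  by_contra hyV
  exact hy ⟨hyB, hyV⟩
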